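/- Let M ⊆ A → A and M' ⊆ B → B be transformation monoids, let G ⊆ M and G' ⊆ M' be submonoids consisting of invertible elements of M and M' respectively, and assume M is contained in the topological closure of G and M' is closed. Then for every continuous monoid homomorphism ξ: G → G' there exists a uniformly continuous monoid homomorphism ξ̄: M → M' extending ξ, i.e. ξ̄(g) = ξ(g) for all g ∈ G. -/

import Mathlib

open Set Function

universe u

/-- The uniformity of pointwise convergence on `I → X` arising from the
discrete uniformity on `X`. -/
noncomputable def funUnif (I X : Type*) : UniformSpace (I → X) :=
  @Pi.uniformSpace I (fun _ => X) (fun _ => ⊥)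

/-- The topology of pointwise convergence on `I → X` (over discrete `X`). -/
noncomputable def funTop (I X : Type*) : TopologicalSpace (I → X) :=
  (funUnif I X).toTopologicalSpace

/-- Topological closure w.r.t. the topology of pointwise convergence. -/
def fClosure {I X : Type*} (S : Set (I → X)) : Set (I → X) :=
  @closure _ (funTop I X) S

/-- Closedness w.r.t. the topology of pointwise convergence. -/
def fIsClosed {I X : Type*} (S : Set (I → X)) : Prop :=
  @IsClosed _ (funTop I X) S

/-- Continuity on a set of functions w.r.t. pointwise convergence topologies. -/
def fContinuousOn {I X J Y : Type*} (ξ : (I → X) → (J → Y)) (S : Set (I → X)) : Prop :=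
  @ContinuousOn _ _ (funTop I X) (funTop J Y) ξ S

/-- Uniform continuity on a set of functions w.r.t. pointwise uniformities. -/
def fUniformContinuousOn {I X J Y : Type*} (ξ : (I → X) → (J → Y)) (S : Set (I → X)) : Prop :=
  @UniformContinuousOn _ _ (funUnif I X) (funUnif J Y) ξ S

/-- A transformation monoid on `A`: a set of self-maps containing the identity
and closed under composition. -/
def IsTransMonoid {A : Type*} (M : Set (A → A)) : Prop :=
  id ∈ M ∧ ∀ f ∈ M, ∀ g ∈ M, f ∘ g ∈ M

/-- The set of invertible elements of a transformation monoid `M`. -/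
def invertibles {A : Type*} (M : Set (A → A)) : Set (A → A) :=
  {g | g ∈ M ∧ ∃ f ∈ M, f ∘ g = id ∧ g ∘ f = id}

/-- A monoid homomorphism from `M` to `M'`, given as a (total) map on functions. -/
def MonHomOn {A B : Type*} (M : Set (A → A)) (M' : Set (B → B))
    (ξ : (A → A) → (B → B)) : Prop :=
  Set.MapsTo ξ M M' ∧ ξ id = id ∧ ∀ f ∈ M, ∀ g ∈ M, ξ (f ∘ g) = ξ f ∘ ξ g

/-- A monoid isomorphism between `M` and `M'`, given by a pair of mutually
inverse monoid homomorphisms. -/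
def MonIsoOn {A B : Type*} (M : Set (A → A)) (M' : Set (B → B))
    (ξ : (A → A) → (B → B)) (ξ' : (B → B) → (A → A)) : Prop :=
  MonHomOn M M' ξ ∧ MonHomOn M' M ξ' ∧
    (∀ f ∈ M, ξ' (ξ f) = f) ∧ (∀ h ∈ M', ξ (ξ' h) = h)

open scoped Uniformity Topology

theorem hasBasis_uniformity_funUnif (I X : Type*) :
    (@uniformity _ (funUnif I X)).HasBasis (fun J : Set I => J.Finite)
      (fun J => {p | EqOn p.1 p.2 J}) := by
  have h : @uniformity _ (funUnif I X) =
      ⨅ i : I, Filter.principal {p : (I → X) × (I → X) | p.1 i = p.2 i} := by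
    let : UniformSpace X := ⊥
    change 𝓤 (I → X) = _
    rw [Pi.uniformity]
    refine iInf_congr fun i => ?_
    change Filter.comap _ (Filter.principal SetRel.id) = _
    rw [Filter.comap_principal]
    rfl
  rw [h]
  refine (Filter.hasBasis_iInf_principal_finite _).congr (fun _ => Iff.rfl) fun J _ => ?_
  ext p
  simp [EqOn]

theorem hasBasis_nhds_funTop {I X : Type*} (f : I → X) :
    (@nhds _ (funTop I X) f).HasBasis (fun J : Set I => J.Finite)
      (fun J => {g | EqOn f g J}) :=
  letI := funUnif I X
  nhds_basis_uniformity' (hasBasis_uniformity_funUnif I X)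

theorem mem_fClosure_iff {I X : Type*} {S : Set (I → X)} {f : I → X} :
    f ∈ fClosure S ↔ ∀ J : Set I, J.Finite → ∃ g ∈ S, EqOn f g J :=
  letI := funTop I X
  (mem_closure_iff_nhds_basis (hasBasis_nhds_funTop f))

theorem fContinuousOn.exists_finite {I X J Y : Type*} {ξ : (I → X) → (J → Y)}
    {S : Set (I → X)} (h : fContinuousOn ξ S) {f : I → X} (hf : f ∈ S) (b : J) :
    ∃ K : Set I, K.Finite ∧ ∀ g ∈ S, EqOn f g K → ξ f b = ξ g b := by
  let := funTop I X
  let := funTop J Y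
  have hb := ((hasBasis_nhds_funTop f).inf_principal S).tendsto_iff
    (hasBasis_nhds_funTop (ξ f)) |>.1 (h f hf) {b} (finite_singleton b)
  obtain ⟨K, hK, hKb⟩ := hb
  exact ⟨K, hK, fun g hg hfg => hKb g ⟨hfg, hg⟩ rfl⟩

theorem fUniformContinuousOn_of_exists_finite {I X J Y : Type*} {ξ : (I → X) → (J → Y)}
    {S : Set (I → X)}
    (h : ∀ b, ∃ K : Set I, K.Finite ∧ ∀ f ∈ S, ∀ g ∈ S, EqOn f g K → ξ f b = ξ g b) :
    fUniformContinuousOn ξ S := by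
  let := funUnif I X
  let := funUnif J Y
  choose K hK hKξ using h
  refine ((hasBasis_uniformity_funUnif I X).inf_principal (S ×ˢ S)).tendsto_iff
    (hasBasis_uniformity_funUnif J Y) |>.2 fun L hL => ?_
  refine ⟨⋃ b ∈ L, K b, hL.biUnion fun b _ => hK b, ?_⟩
  rintro ⟨f, g⟩ ⟨hfg, hf, hg⟩ b hb
  exact hKξ b f hf g hg (hfg.mono (subset_biUnion_of_mem hb))

/-- A continuous homomorphism to injective maps is uniformly continuous on a monoid of
maps whose inverses can be approximated within the monoid. -/
theorem MonHomOn.exists_finite_of_fContinuousOn {A B : Type*} {G : Set (A → A)}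
    {G' : Set (B → B)} {ξ : (A → A) → (B → B)} (hG : IsTransMonoid G)
    (hinv : ∀ f ∈ G, ∃ k ∈ fClosure G, k ∘ f = id) (hinj : ∀ h ∈ G', Injective h)
    (hhom : MonHomOn G G' ξ) (hcont : fContinuousOn ξ G) (b : B) :
    ∃ J : Set A, J.Finite ∧ ∀ f ∈ G, ∀ g ∈ G, EqOn f g J → ξ f b = ξ g b := by
  obtain ⟨hmaps, hid, hcomp⟩ := hhom
  obtain ⟨J, hJ, hJb⟩ := hcont.exists_finite hG.1 b
  refine ⟨J, hJ, fun f hf g hg hfg => ?_⟩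
  obtain ⟨k, hk, hkf⟩ := hinv f hf
  obtain ⟨h, hh, hkh⟩ := mem_fClosure_iff.1 hk (f '' J) (hJ.image f)
  have hhf : EqOn id (h ∘ f) J := fun a ha => by
    rw [comp_apply, ← hkh (mem_image_of_mem f ha), ← hkf, comp_apply]
  have hhg : EqOn id (h ∘ g) J := fun a ha => by
    rw [hhf ha, comp_apply, comp_apply, hfg ha]
  have e := (hJb _ (hG.2 h hh f hf) hhf).symm.trans (hJb _ (hG.2 h hh g hg) hhg)
  rw [hcomp h hh f hf, hcomp h hh g hg] at e
  exact hinj _ (hmaps hh) e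

/-- Extension of continuous monoid homomorphisms between
groups of invertibles to uniformly continuous monoid homomorphisms between
the monoids, when the group lies dense and the target monoid is closed. -/
theorem exists_uniformContinuous_extension
    {A B : Type*} (M : Set (A → A)) (M' : Set (B → B))
    (G : Set (A → A)) (G' : Set (B → B))
    (hM : IsTransMonoid M) (hM' : IsTransMonoid M')
    (hG : IsTransMonoid G) (hG' : IsTransMonoid G')
    (hGinv : G ⊆ invertibles M) (hG'inv : G' ⊆ invertibles M')
    (hdense : M ⊆ fClosure G) (hM'closed : fIsClosed M')
    (ξ : (A → A) → (B → B)) (hhom : MonHomOn G G' ξ)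
    (hcont : fContinuousOn ξ G) :
    ∃ ξbar : (A → A) → (B → B),
      MonHomOn M M' ξbar ∧ fUniformContinuousOn ξbar M ∧ ∀ g ∈ G, ξbar g = ξ g := by
  have hinv : ∀ f ∈ G, ∃ k ∈ fClosure G, k ∘ f = id := fun f hf => by
    obtain ⟨-, k, hk, hkf, -⟩ := hGinv hf
    exact ⟨k, hdense hk, hkf⟩
  have hinj : ∀ h ∈ G', Injective h := fun h hh => by
    obtain ⟨-, k, -, hkh, -⟩ := hG'inv hh
    exact LeftInverse.injective (g := k) (congrFun hkh)
  choose J hJ hJξ using hhom.exists_finite_of_fContinuousOn hG hinv hinj hcont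
  obtain ⟨hmaps, hid, hcomp⟩ := hhom
  have hGM : G ⊆ M := fun g hg => (hGinv hg).1
  have happrox : ∀ f ∈ M, ∀ K : Set A, K.Finite → ∃ g ∈ G, EqOn f g K :=
    fun f hf => mem_fClosure_iff.1 (hdense hf)
  have hex : ∀ f b, ∃ c, f ∈ M → ∀ g ∈ G, EqOn f g (J b) → c = ξ g b := fun f b => by
    by_cases hf : f ∈ M
    · obtain ⟨g, hg, hfg⟩ := happrox f hf (J b) (hJ b)
      exact ⟨ξ g b, fun _ g' hg' hfg' => hJξ b g hg g' hg' (hfg.symm.trans hfg')⟩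
    · exact ⟨b, fun h => absurd h hf⟩
  choose ξbar hξbar using hex
  have hext : ∀ g ∈ G, ξbar g = ξ g := fun g hg =>
    funext fun b => hξbar g b (hGM hg) g hg fun _ _ => rfl
  refine ⟨ξbar, ⟨fun f hf => ?_, (hext id hG.1).trans hid, fun f₁ hf₁ f₂ hf₂ => ?_⟩,
    fUniformContinuousOn_of_exists_finite fun b => ⟨J b, hJ b, fun f hf g hg hfg => ?_⟩, hext⟩
  · have hcl : fClosure M' = M' := @IsClosed.closure_eq _ (funTop B B) _ hM'closed
    rw [← hcl, mem_fClosure_iff]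
    intro K hK
    obtain ⟨g, hg, hfg⟩ := happrox f hf (⋃ b ∈ K, J b) (hK.biUnion fun b _ => hJ b)
    exact ⟨ξ g, (hG'inv (hmaps hg)).1, fun b hb =>
      hξbar f b hf g hg (hfg.mono (subset_biUnion_of_mem hb))⟩
  · funext b
    obtain ⟨g₂, hg₂, h₂⟩ := happrox f₂ hf₂ (J b) (hJ b)
    obtain ⟨g₁, hg₁, h₁⟩ := happrox f₁ hf₁ (J (ξbar f₂ b) ∪ g₂ '' J b)
      ((hJ _).union ((hJ b).image g₂))
    have h₁₂ : EqOn (f₁ ∘ f₂) (g₁ ∘ g₂) (J b) := fun a ha => by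
      rw [comp_apply, comp_apply, h₂ ha, h₁ (Or.inr (mem_image_of_mem g₂ ha))]
    rw [hξbar _ b (hM.2 f₁ hf₁ f₂ hf₂) _ (hG.2 g₁ hg₁ g₂ hg₂) h₁₂, hcomp g₁ hg₁ g₂ hg₂,
      comp_apply, comp_apply, hξbar f₁ _ hf₁ g₁ hg₁ (h₁.mono subset_union_left),
      hξbar f₂ b hf₂ g₂ hg₂ h₂]
  · obtain ⟨k, hk, hgk⟩ := happrox g hg (J b) (hJ b)
    rw [hξbar f b hf k hk (hfg.trans hgk), hξbar g b hg k hk hgk]
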